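/- Theorem 2 (finite-horizon supremum form): For a non-controllable FSC and 0 ≤ u ≤ v, the supremum of the finite-horizon information objective over all sources with u-delayed FB and u-delayed SI is attained within the class of v-th order conditional Markov sources: sup_{P ∈ 𝒫(u,u)} Σ_{t=1}^N I^P(X_{t-v}^t, S_{t-v-1}; Y_t | Y^{t-1}) = sup_{P ∈ 𝒫_v(u,u)} Σ_{t=1}^N I^P(X_{t-v}^t, S_{t-v-1}; Y_t | Y^{t-1}), where I^P denotes conditional mutual information under the joint law induced by the source P (windows truncated for small t). -/

import Mathlib

/-!
Common framework: finite-state channels (FSCs), non-controllable FSCs,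
sources with delayed feedback (FB) and delayed state information (SI),
induced joint pmfs, conditional probabilities and conditional mutual
information, following Huang–Kavčić–Ma, "Upper Bounds on the Capacities of
Non-Controllable Finite-State Channels with/without Feedback".

Time convention: for a horizon `N`, the channel inputs are `X_1,…,X_N`
(coordinate `x i` of `x : Fin N → X` is `X_{i+1}`), the states are
`S_0,…,S_N` (coordinate `s j` of `s : Fin (N+1) → S` is `S_j`), and the
outputs are `Y_1,…,Y_N` (coordinate `y i` is `Y_{i+1}`).
-/

open Finset

noncomputable section

namespace FSCPaper

/-- Probability of an event under a pmf `p` on a finite sample space. -/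
def prE {Ω : Type} [Fintype Ω] (p : Ω → ℝ) (E : Set Ω) : ℝ :=
  ∑ ω : Ω, E.indicator p ω

/-- Conditional probability `Pr(E | F)`, a ratio of (sums of) marginals
(with the `0/0 = 0` junk-value convention of real division). -/
def condPr {Ω : Type} [Fintype Ω] (p : Ω → ℝ) (E F : Set Ω) : ℝ :=
  prE p (E ∩ F) / prE p F

/-- The conditional pmf `Pr(· | F)` given an event `F`. -/
def condPMF {Ω : Type} [Fintype Ω] (p : Ω → ℝ) (F : Set Ω) : Ω → ℝ :=
  fun ω => F.indicator p ω / prE p F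

/-- Conditional mutual information `I(A;B|C)` of finite-valued random
variables `fA, fB, fC` under the pmf `p`; zero-probability terms
contribute `0` (the factor in front of the logarithm vanishes). -/
def condMI {Ω A B C : Type} [Fintype Ω] [Fintype A] [Fintype B] [Fintype C]
    (p : Ω → ℝ) (fA : Ω → A) (fB : Ω → B) (fC : Ω → C) : ℝ :=
  ∑ a : A, ∑ b : B, ∑ c : C,
    prE p {ω | fA ω = a ∧ fB ω = b ∧ fC ω = c} *
      Real.log (condPr p {ω | fA ω = a ∧ fB ω = b} {ω | fC ω = c} /
        (condPr p {ω | fA ω = a} {ω | fC ω = c} *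
          condPr p {ω | fB ω = b} {ω | fC ω = c}))

/-- Trajectories `(x_1^N, s_0^N, y_1^N)`. -/
abbrev Traj (X S Y : Type) (N : ℕ) : Type :=
  (Fin N → X) × (Fin (N + 1) → S) × (Fin N → Y)

/-- A general finite-state channel: channel transition kernel
`W(y, s' | x, s)` (a pmf on `Y × S` for each `(x,s)`) and initial state
pmf `init`. -/
structure FSC (X S Y : Type) [Fintype S] [Fintype Y] : Type where
  W : Y → S → X → S → ℝ
  init : S → ℝ
  W_nonneg : ∀ y s' x s, 0 ≤ W y s' x s
  W_sum : ∀ x s, (∑ y : Y, ∑ s' : S, W y s' x s) = 1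
  init_nonneg : ∀ s, 0 ≤ init s
  init_sum : (∑ s : S, init s) = 1

/-- A source without feedback: conditional pmfs `π_t(x_t | x^{t-1})`;
`pol t x a` is the probability that `X_{t+1} = a` given that the previous
inputs are the corresponding coordinates of `x` (by `causal` it depends
only on the coordinates `x j` with `j < t`). -/
structure FFSource (X : Type) [Fintype X] (N : ℕ) : Type where
  pol : Fin N → (Fin N → X) → X → ℝ
  nonneg : ∀ t x a, 0 ≤ pol t x a
  sum_one : ∀ t x, (∑ a : X, pol t x a) = 1
  causal : ∀ (t : Fin N) (x x' : Fin N → X),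
    (∀ j : Fin N, (j : ℕ) < (t : ℕ) → x j = x' j) → pol t x = pol t x'

/-- A non-controllable finite-state channel: output kernel `P(y|x,s)`,
free state-transition kernel `Q(s'|s)`, and initial state pmf `init`. -/
structure NCFSC (X S Y : Type) [Fintype S] [Fintype Y] : Type where
  P : Y → X → S → ℝ
  Q : S → S → ℝ
  init : S → ℝ
  P_nonneg : ∀ y x s, 0 ≤ P y x s
  P_sum : ∀ x s, (∑ y : Y, P y x s) = 1
  Q_nonneg : ∀ s' s, 0 ≤ Q s' s
  Q_sum : ∀ s, (∑ s' : S, Q s' s) = 1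
  init_nonneg : ∀ s, 0 ≤ init s
  init_sum : (∑ s : S, init s) = 1

/-- A source with `u`-delayed feedback and `u`-delayed state information
(the set `𝒫(u,u)`): `pol t x s y a` is
`π_{t+1}(a | x^{t}, s_0^{t-u}, y^{t-u})` in 1-based time; by `causal` it
depends on `(x, s, y)` only through the coordinates
`x_1^{t}` (indices `j < t`), `s_0^{t-u}` (indices `j + u ≤ t`) and
`y_1^{t-u}` (indices `j + u + 1 ≤ t`), i.e. on the past inputs, the
`u`-delayed state information and the `u`-delayed output feedback. -/
structure Source (X S Y : Type) [Fintype X] [Fintype S] [Fintype Y] (N u : ℕ) : Type where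
  pol : Fin N → (Fin N → X) → (Fin (N + 1) → S) → (Fin N → Y) → X → ℝ
  nonneg : ∀ t x s y a, 0 ≤ pol t x s y a
  sum_one : ∀ t x s y, (∑ a : X, pol t x s y a) = 1
  causal : ∀ (t : Fin N) (x x' : Fin N → X) (s s' : Fin (N + 1) → S) (y y' : Fin N → Y),
    (∀ j : Fin N, (j : ℕ) < (t : ℕ) → x j = x' j) →
    (∀ j : Fin (N + 1), (j : ℕ) + u ≤ (t : ℕ) → s j = s' j) →
    (∀ j : Fin N, (j : ℕ) + u + 1 ≤ (t : ℕ) → y j = y' j) →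
    pol t x s y = pol t x' s' y'

variable {X S Y : Type} [Fintype X] [Fintype S] [Fintype Y]

/-- Joint pmf induced by a general FSC and a feedforward source:
`Pr(x^N, s_0^N, y^N) = μ(s_0) ∏_t π_t(x_t|x^{t-1}) W(y_t, s_t | x_t, s_{t-1})`. -/
def jointP0 {N : ℕ} (ch : FSC X S Y) (src : FFSource X N) (ω : Traj X S Y N) : ℝ :=
  ch.init (ω.2.1 0) *
    ∏ i : Fin N,
      src.pol i ω.1 (ω.1 i) *
        ch.W (ω.2.2 i) (ω.2.1 i.succ) (ω.1 i) (ω.2.1 i.castSucc)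

/-- Joint channel transition `W(y, s' | x, s) = P(y|x,s) · Q(s'|s)` of a
non-controllable FSC. -/
def NCFSC.W (ch : NCFSC X S Y) (y : Y) (s' : S) (x : X) (s : S) : ℝ :=
  ch.P y x s * ch.Q s' s

/-- Joint pmf induced by a non-controllable FSC and a source in `𝒫(u,u)`:
`Pr(x^N, s_0^N, y^N) = μ(s_0) ∏_t π_t(x_t|x^{t-1},s_0^{t-u-1},y^{t-u-1}) W(y_t,s_t|x_t,s_{t-1})`. -/
def jointP {N u : ℕ} (ch : NCFSC X S Y) (src : Source X S Y N u) (ω : Traj X S Y N) : ℝ :=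
  ch.init (ω.2.1 0) *
    ∏ i : Fin N,
      src.pol i ω.1 ω.2.1 ω.2.2 (ω.1 i) *
        ch.W (ω.2.2 i) (ω.2.1 i.succ) (ω.1 i) (ω.2.1 i.castSucc)

/-- A source in `𝒫(u,u)` is a `v`-th order conditional Markov source
(the set `𝒫_v(u,u)`) if each policy depends on its arguments only through
`(x_{t-v}^{t-1}, s_{t-v-1}^{t-u-1}, y^{t-u-1})` (windows truncated for
small `t`). -/
def IsMarkov {N u : ℕ} (v : ℕ) (src : Source X S Y N u) : Prop :=
  ∀ (t : Fin N) (x x' : Fin N → X) (s s' : Fin (N + 1) → S) (y y' : Fin N → Y),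
    (∀ j : Fin N, (t : ℕ) ≤ (j : ℕ) + v ∧ (j : ℕ) < (t : ℕ) → x j = x' j) →
    (∀ j : Fin (N + 1), (t : ℕ) ≤ (j : ℕ) + v ∧ (j : ℕ) + u ≤ (t : ℕ) → s j = s' j) →
    (∀ j : Fin N, (j : ℕ) + u + 1 ≤ (t : ℕ) → y j = y' j) →
    src.pol t x s y = src.pol t x' s' y'

/-- `Σ_{t=1}^N I(X^t, S_0^{t-v-1}; Y_t | Y^{t-1})` under the joint law of
the source (state window omitted/truncated when `t - v - 1 < 0`). -/
def objFull {N u : ℕ} (v : ℕ) (ch : NCFSC X S Y) (src : Source X S Y N u) : ℝ :=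
  ∑ t : Fin N,
    condMI (jointP ch src)
      (fun ω : Traj X S Y N =>
        ((fun j : {j : Fin N // (j : ℕ) ≤ (t : ℕ)} => ω.1 j.1),
          fun j : {j : Fin (N + 1) // (j : ℕ) + v ≤ (t : ℕ)} => ω.2.1 j.1))
      (fun ω => ω.2.2 t)
      (fun ω => fun j : {j : Fin N // (j : ℕ) < (t : ℕ)} => ω.2.2 j.1)

/-- `Σ_{t=1}^N I(X_{t-v}^t, S_{t-v-1}; Y_t | Y^{t-1})` under the joint law
of the source (windows truncated for small `t`; the singleton state window
`S_{t-v-1}` is encoded by the condition `j + v = t - 1` in 0-based time and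
is empty for `t ≤ v`). -/
def objWin {N u : ℕ} (v : ℕ) (ch : NCFSC X S Y) (src : Source X S Y N u) : ℝ :=
  ∑ t : Fin N,
    condMI (jointP ch src)
      (fun ω : Traj X S Y N =>
        ((fun j : {j : Fin N // (t : ℕ) ≤ (j : ℕ) + v ∧ (j : ℕ) ≤ (t : ℕ)} => ω.1 j.1),
          fun j : {j : Fin (N + 1) // (j : ℕ) + v = (t : ℕ)} => ω.2.1 j.1))
      (fun ω => ω.2.2 t)
      (fun ω => fun j : {j : Fin N // (j : ℕ) < (t : ℕ)} => ω.2.2 j.1)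

/-- Directed information `I(X^N → Y^N) = Σ_{t=1}^N I(X^t; Y_t | Y^{t-1})`. -/
def directedInfo {N u : ℕ} (ch : NCFSC X S Y) (src : Source X S Y N u) : ℝ :=
  ∑ t : Fin N,
    condMI (jointP ch src)
      (fun ω : Traj X S Y N => fun j : {j : Fin N // (j : ℕ) ≤ (t : ℕ)} => ω.1 j.1)
      (fun ω => ω.2.2 t)
      (fun ω => fun j : {j : Fin N // (j : ℕ) < (t : ℕ)} => ω.2.2 j.1)

/-- The a posteriori vectors `α_{t-1}(y^{t-u-1})` and `α_{t-1}(ỹ^{t-u-1})`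
(at the 1-based time `(t:ℕ)+1`) induced by the two output histories `yh`
and `yh'` coincide: for all window values `(x_{t-v}^{t-1}, s_{t-v-1}^{t-u-1})`
the two a posteriori probabilities agree. -/
def alphaWinEq {N u : ℕ} (v : ℕ) (ch : NCFSC X S Y) (src : Source X S Y N u)
    (t : Fin N) (yh yh' : Fin N → Y) : Prop :=
  ∀ (xf : Fin N → X) (sf : Fin (N + 1) → S),
    condPr (jointP ch src)
        {ω : Traj X S Y N |
          (∀ j : Fin N, (t : ℕ) ≤ (j : ℕ) + v ∧ (j : ℕ) < (t : ℕ) → ω.1 j = xf j) ∧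
            ∀ j : Fin (N + 1), (t : ℕ) ≤ (j : ℕ) + v ∧ (j : ℕ) + u ≤ (t : ℕ) → ω.2.1 j = sf j}
        {ω : Traj X S Y N | ∀ j : Fin N, (j : ℕ) + u + 1 ≤ (t : ℕ) → ω.2.2 j = yh j} =
      condPr (jointP ch src)
        {ω : Traj X S Y N |
          (∀ j : Fin N, (t : ℕ) ≤ (j : ℕ) + v ∧ (j : ℕ) < (t : ℕ) → ω.1 j = xf j) ∧
            ∀ j : Fin (N + 1), (t : ℕ) ≤ (j : ℕ) + v ∧ (j : ℕ) + u ≤ (t : ℕ) → ω.2.1 j = sf j}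
        {ω : Traj X S Y N | ∀ j : Fin N, (j : ℕ) + u + 1 ≤ (t : ℕ) → ω.2.2 j = yh' j}

/-- The set `𝒫'_v(u,u)`: the policy at each time gives the same value on
any two positive-probability output histories inducing the same a
posteriori vector. -/
def AlphaPolicy {N u : ℕ} (v : ℕ) (ch : NCFSC X S Y) (src : Source X S Y N u) : Prop :=
  ∀ (t : Fin N) (yh yh' : Fin N → Y),
    0 < prE (jointP ch src)
        {ω : Traj X S Y N | ∀ j : Fin N, (j : ℕ) + u + 1 ≤ (t : ℕ) → ω.2.2 j = yh j} →
    0 < prE (jointP ch src)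
        {ω : Traj X S Y N | ∀ j : Fin N, (j : ℕ) + u + 1 ≤ (t : ℕ) → ω.2.2 j = yh' j} →
    alphaWinEq v ch src t yh yh' →
    ∀ (xf : Fin N → X) (sf : Fin (N + 1) → S) (a : X),
      src.pol t xf sf yh a = src.pol t xf sf yh' a

set_option linter.unusedSectionVars false

/-! ### Auxiliary material for the proof -/

/-- Averaging over one block of coordinates (read by `get`, written by `upd`). -/
theorem lens_sum {Ω β : Type} [Fintype Ω] [Fintype β] (get : Ω → β) (upd : Ω → β → Ω)
    (h1 : ∀ ω b, upd (upd ω b) (get ω) = ω) (h2 : ∀ ω b, get (upd ω b) = b)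
    (q κ f : Ω → ℝ) (hq : ∀ ω b, q (upd ω b) = q ω) :
    (Fintype.card β : ℝ) * ∑ ω, q ω * κ ω * f ω =
      ∑ ω, q ω * ∑ b, κ (upd ω b) * f (upd ω b) := by
  have hinv : Function.Involutive (fun z : Ω × β => (upd z.1 z.2, get z.1)) := by
    rintro ⟨ω, b⟩
    simp [h1, h2]
  have e := Equiv.sum_comp hinv.toPerm (fun z : Ω × β => q z.1 * κ z.1 * f z.1)
  rw [Fintype.sum_prod_type, Fintype.sum_prod_type] at e
  simp only [Function.Involutive.coe_toPerm, hq, sum_const, card_univ, nsmul_eq_mul] at e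
  rw [mul_sum, ← e]
  refine sum_congr rfl fun ω _ => ?_
  rw [mul_sum]
  exact sum_congr rfl fun b _ => by ring

theorem lens_cancel {Ω β : Type} [Fintype Ω] [Fintype β] (get : Ω → β) (F G : Ω → ℝ)
    (h : (Fintype.card β : ℝ) * ∑ ω, F ω = (Fintype.card β : ℝ) * ∑ ω, G ω) :
    ∑ ω, F ω = ∑ ω, G ω := by
  rcases isEmpty_or_nonempty Ω with hΩ | ⟨⟨ω⟩⟩
  · simp
  · have : Nonempty β := ⟨get ω⟩
    have hc : (Fintype.card β : ℝ) ≠ 0 := by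
      exact_mod_cast Fintype.card_ne_zero
    exact mul_left_cancel₀ hc h

theorem prod_lt_succ {n : ℕ} (a : Fin n → ℝ) (t : Fin n) :
    (∏ i : Fin n, if (i : ℕ) < (t : ℕ) + 1 then a i else 1) =
      (∏ i : Fin n, if (i : ℕ) < (t : ℕ) then a i else 1) * a t := by
  have : a t = ∏ i : Fin n, if i = t then a i else 1 := by simp
  rw [this, ← prod_mul_distrib]
  refine prod_congr rfl fun i _ => ?_
  by_cases h : i = t
  · subst h; simp
  · have h' : (i : ℕ) ≠ t := fun e => h (Fin.ext e)
    have : (i : ℕ) < (t : ℕ) + 1 ↔ (i : ℕ) < t := by omega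
    simp [h, this]

/-- State/output factor number `j` of the joint law. -/
def lev {N : ℕ} (ch : NCFSC X S Y) (j : Fin (N + 1)) (ω : Traj X S Y N) : ℝ :=
  Fin.cases (motive := fun _ => ℝ) (ch.init (ω.2.1 0))
    (fun i => ch.W (ω.2.2 i) (ω.2.1 i.succ) (ω.1 i) (ω.2.1 i.castSucc)) j

/-- Partial weight: the first `t` policies and the first `k` state/output factors. -/
def qw {N u : ℕ} (ch : NCFSC X S Y) (src : Source X S Y N u) (t k : ℕ)
    (ω : Traj X S Y N) : ℝ :=
  (∏ i : Fin N, if (i : ℕ) < t then src.pol i ω.1 ω.2.1 ω.2.2 (ω.1 i) else 1) *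
    ∏ j : Fin (N + 1), if (j : ℕ) < k then lev ch j ω else 1

/-- Agreement of two trajectories on a window. -/
def rel {N : ℕ} (v a b k : ℕ) (ω ω' : Traj X S Y N) : Prop :=
  (∀ j : Fin N, a ≤ (j : ℕ) + v ∧ (j : ℕ) < b → ω.1 j = ω'.1 j) ∧
  (∀ j : Fin (N + 1), a ≤ (j : ℕ) + v ∧ (j : ℕ) < k → ω.2.1 j = ω'.2.1 j) ∧
  (∀ j : Fin N, (j : ℕ) + 1 < k → ω.2.2 j = ω'.2.2 j)

theorem lev_nonneg {N : ℕ} (ch : NCFSC X S Y) (j : Fin (N + 1)) (ω : Traj X S Y N) :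
    0 ≤ lev ch j ω := by
  refine Fin.cases ?_ (fun i => ?_) j
  · exact ch.init_nonneg _
  · exact mul_nonneg (ch.P_nonneg _ _ _) (ch.Q_nonneg _ _)

theorem qw_nonneg {N u : ℕ} (ch : NCFSC X S Y) (src : Source X S Y N u) (t k : ℕ)
    (ω : Traj X S Y N) : 0 ≤ qw ch src t k ω := by
  refine mul_nonneg (prod_nonneg fun i _ => ?_) (prod_nonneg fun i _ => ?_)
  · split_ifs
    · exact src.nonneg _ _ _ _ _
    · exact zero_le_one
  · split_ifs
    · exact lev_nonneg _ _ _
    · exact zero_le_one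

theorem qw_top {N u : ℕ} (ch : NCFSC X S Y) (src : Source X S Y N u) (ω : Traj X S Y N) :
    qw ch src N (N + 1) ω = jointP ch src ω := by
  unfold qw jointP
  simp only [Fin.is_lt, if_true]
  rw [Fin.prod_univ_succ, prod_mul_distrib]
  simp only [lev, Fin.cases_zero, Fin.cases_succ]
  ring

theorem qw_succ_x {N u : ℕ} (ch : NCFSC X S Y) (src : Source X S Y N u) (t : Fin N) (k : ℕ)
    (ω : Traj X S Y N) :
    qw ch src (t + 1) k ω = qw ch src t k ω * src.pol t ω.1 ω.2.1 ω.2.2 (ω.1 t) := by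
  unfold qw
  rw [prod_lt_succ]
  ring

theorem qw_succ_l {N u : ℕ} (ch : NCFSC X S Y) (src : Source X S Y N u) (t : ℕ)
    (k : Fin (N + 1)) (ω : Traj X S Y N) :
    qw ch src t (k + 1) ω = qw ch src t k ω * lev ch k ω := by
  unfold qw
  rw [prod_lt_succ]
  ring

/-- `lev j` depends only on the coordinates listed. -/
theorem lev_congr {N : ℕ} (ch : NCFSC X S Y) (j : Fin (N + 1)) (ω ω' : Traj X S Y N)
    (hx : ∀ i : Fin N, (i : ℕ) + 1 = j → ω.1 i = ω'.1 i)
    (hs : ∀ i : Fin (N + 1), (i : ℕ) = j ∨ (i : ℕ) + 1 = j → ω.2.1 i = ω'.2.1 i)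
    (hy : ∀ i : Fin N, (i : ℕ) + 1 = j → ω.2.2 i = ω'.2.2 i) :
    lev ch j ω = lev ch j ω' := by
  revert hx hs hy
  refine Fin.cases ?_ (fun i => ?_) j
  · intro hx hs hy
    simp only [lev, Fin.cases_zero]
    rw [hs 0 (by simp)]
  · intro hx hs hy
    simp only [lev, Fin.cases_succ]
    rw [hx i (by simp), hy i (by simp), hs i.succ (by simp), hs i.castSucc (by simp)]

/-- The partial weight depends only on the coordinates generated so far. -/
theorem qw_congr {N u : ℕ} (ch : NCFSC X S Y) (src : Source X S Y N u) (t k : ℕ)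
    (hk : k ≤ t + 1) (ht : t ≤ k + u) (ω ω' : Traj X S Y N)
    (hx : ∀ i : Fin N, (i : ℕ) < t → ω.1 i = ω'.1 i)
    (hs : ∀ i : Fin (N + 1), (i : ℕ) < k → ω.2.1 i = ω'.2.1 i)
    (hy : ∀ i : Fin N, (i : ℕ) + 1 < k → ω.2.2 i = ω'.2.2 i) :
    qw ch src t k ω = qw ch src t k ω' := by
  unfold qw
  congr 1
  · refine prod_congr rfl fun i _ => ?_
    split_ifs with h
    · rw [hx i h, src.causal i ω.1 ω'.1 ω.2.1 ω'.2.1 ω.2.2 ω'.2.2]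
      · intro j hj; exact hx j (by omega)
      · intro j hj; exact hs j (by omega)
      · intro j hj; exact hy j (by omega)
    · rfl
  · refine prod_congr rfl fun i _ => ?_
    split_ifs with h
    · apply lev_congr
      · intro j hj; exact hx j (by omega)
      · intro j hj; exact hs j (by omega)
      · intro j hj; exact hy j (by omega)
    · rfl

/-- Overwrite `x_t`. -/
def updX {N : ℕ} (t : Fin N) (ω : Traj X S Y N) (a : X) : Traj X S Y N :=
  (Function.update ω.1 t a, ω.2.1, ω.2.2)

/-- Overwrite `s_0`. -/
def updS {N : ℕ} (ω : Traj X S Y N) (a : S) : Traj X S Y N :=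
  (ω.1, Function.update ω.2.1 0 a, ω.2.2)

/-- Overwrite `(s_{i+1}, y_i)`. -/
def updSY {N : ℕ} (i : Fin N) (ω : Traj X S Y N) (a : S × Y) : Traj X S Y N :=
  (ω.1, Function.update ω.2.1 i.succ a.1, Function.update ω.2.2 i a.2)

theorem step_x {N u : ℕ} (ch : NCFSC X S Y) (src : Source X S Y N u) (t : Fin N) (k : ℕ)
    (hk : k ≤ t + 1) (ht : (t : ℕ) ≤ k + u) (f : Traj X S Y N → ℝ) :
    (Fintype.card X : ℝ) * ∑ ω, qw ch src (t + 1) k ω * f ω =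
      ∑ ω, qw ch src t k ω * ∑ a, src.pol t ω.1 ω.2.1 ω.2.2 a * f (updX t ω a) := by
  simp only [qw_succ_x]
  rw [lens_sum (fun ω : Traj X S Y N => ω.1 t) (updX t)]
  · refine sum_congr rfl fun ω _ => ?_
    congr 1
    refine sum_congr rfl fun a _ => ?_
    congr 1
    rw [src.causal t (updX t ω a).1 ω.1 (updX t ω a).2.1 ω.2.1 (updX t ω a).2.2 ω.2.2]
    · simp [updX]
    · intro j hj
      have : j ≠ t := by rintro rfl; omega
      simp [updX, this]
    · intro j hj; rfl
    · intro j hj; rfl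
  · intro ω b; simp [updX]
  · intro ω b; simp [updX]
  · intro ω b
    apply qw_congr _ _ _ _ hk ht
    · intro j hj
      have : j ≠ t := by rintro rfl; omega
      simp [updX, this]
    · intro j hj; rfl
    · intro j hj; rfl

/-- Properties of a block of coordinates generated by the factor `lev k`. -/
theorem exists_lens {N : ℕ} (ch : NCFSC X S Y) (k : Fin (N + 1)) :
    ∃ (β : Type) (_ : Fintype β) (get : Traj X S Y N → β)
      (upd : Traj X S Y N → β → Traj X S Y N),
      (∀ ω b, upd (upd ω b) (get ω) = ω) ∧ (∀ ω b, get (upd ω b) = b) ∧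
      (∀ ω b, (upd ω b).1 = ω.1) ∧
      (∀ ω b (i : Fin (N + 1)), i ≠ k → (upd ω b).2.1 i = ω.2.1 i) ∧
      (∀ ω b (i : Fin N), (i : ℕ) + 1 ≠ k → (upd ω b).2.2 i = ω.2.2 i) ∧
      (∀ ω ω' b, (upd ω b).2.1 k = (upd ω' b).2.1 k) ∧
      (∀ ω ω' b (i : Fin N), (i : ℕ) + 1 = k → (upd ω b).2.2 i = (upd ω' b).2.2 i) ∧
      (∀ ω, ∑ b, lev ch k (upd ω b) = 1) := by
  refine Fin.cases ?_ (fun i => ?_) k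
  · refine ⟨S, inferInstance, fun ω => ω.2.1 0, updS, ?_, ?_, ?_, ?_, ?_, ?_, ?_, ?_⟩
    · intro ω b; simp [updS]
    · intro ω b; simp [updS]
    · intro ω b; rfl
    · intro ω b i hi; simp [updS, hi]
    · intro ω b i hi; rfl
    · intro ω ω' b; simp [updS]
    · intro ω ω' b i hi; simp at hi
    · intro ω; simpa [lev, updS] using ch.init_sum
  · refine ⟨S × Y, inferInstance, fun ω => (ω.2.1 i.succ, ω.2.2 i), updSY i,
      ?_, ?_, ?_, ?_, ?_, ?_, ?_, ?_⟩
    · intro ω b; simp [updSY]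
    · intro ω b; simp [updSY]
    · intro ω b; rfl
    · intro ω b j hj; simp [updSY, hj]
    · intro ω b j hj
      have : j ≠ i := by rintro rfl; simp at hj
      simp [updSY, this]
    · intro ω ω' b; simp [updSY]
    · intro ω ω' b j hj
      have : j = i := by ext; simpa using hj
      simp [updSY, this]
    · intro ω
      have hne : i.castSucc ≠ i.succ := (Fin.castSucc_lt_succ).ne
      simp only [lev, updSY, Fin.cases_succ, Function.update_self, ne_eq, hne,
        not_false_eq_true, Function.update_of_ne, NCFSC.W]
      rw [Fintype.sum_prod_type]
      simp only [← sum_mul, ch.P_sum, one_mul, ch.Q_sum]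

/-- One state/output step: equality of the functionals propagates. -/
theorem step_l {N u : ℕ} (ch : NCFSC X S Y) (src src' : Source X S Y N u) (v : ℕ) (huv : u ≤ v)
    (t : ℕ) (k : Fin (N + 1)) (hk : (k : ℕ) ≤ t + 1) (ht : t + 1 ≤ k + u)
    (H : ∀ f : Traj X S Y N → ℝ, (∀ ω ω', rel v t (t + 1) k ω ω' → f ω = f ω') →
      ∑ ω, qw ch src (t + 1) k ω * f ω = ∑ ω, qw ch src' (t + 1) k ω * f ω)
    (f : Traj X S Y N → ℝ) (hf : ∀ ω ω', rel v t (t + 1) (k + 1) ω ω' → f ω = f ω') :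
    ∑ ω, qw ch src (t + 1) (k + 1) ω * f ω = ∑ ω, qw ch src' (t + 1) (k + 1) ω * f ω := by
  obtain ⟨β, _, get, upd, h1, h2, hx, hs, hy, hs', hy', -⟩ := exists_lens (X := X) (Y := Y) ch k
  have hq : ∀ (sr : Source X S Y N u) ω b,
      qw ch sr (t + 1) k (upd ω b) = qw ch sr (t + 1) k ω := by
    intro sr ω b
    apply qw_congr _ _ _ _ (by omega) (by omega)
    · intro j _; rw [hx]
    · intro j hj; exact hs _ _ _ (by rintro rfl; omega)
    · intro j hj; exact hy _ _ _ (by omega)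
  apply lens_cancel get
  simp only [qw_succ_l]
  rw [lens_sum get upd h1 h2 _ _ _ (hq src), lens_sum get upd h1 h2 _ _ _ (hq src')]
  apply H
  rintro ω ω' ⟨r1, r2, r3⟩
  refine sum_congr rfl fun b _ => ?_
  have hsl : ∀ j : Fin (N + 1), t ≤ (j : ℕ) + v ∧ (j : ℕ) < k + 1 →
      (upd ω b).2.1 j = (upd ω' b).2.1 j := by
    intro j hj
    by_cases e : j = k
    · rw [e]; exact hs' _ _ _
    · have : (j : ℕ) ≠ k := fun h => e (Fin.ext h)
      rw [hs _ _ _ e, hs _ _ _ e]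
      exact r2 j (by omega)
  have hyl : ∀ j : Fin N, (j : ℕ) + 1 < k + 1 → (upd ω b).2.2 j = (upd ω' b).2.2 j := by
    intro j hj
    by_cases e : (j : ℕ) + 1 = k
    · exact hy' _ _ _ _ e
    · rw [hy _ _ _ e, hy _ _ _ e]
      exact r3 j (by omega)
  congr 1
  · apply lev_congr
    · intro i hi; rw [hx, hx]; exact r1 i (by omega)
    · intro i hi; exact hsl i (by omega)
    · intro i hi; exact hyl i (by omega)
  · apply hf
    refine ⟨?_, hsl, hyl⟩
    intro i hi; rw [hx, hx]; exact r1 i hi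

/-- Adding later coordinates does not matter. -/
theorem step_up {N u : ℕ} (ch : NCFSC X S Y) (src src' : Source X S Y N u) (m : Fin N)
    (f : Traj X S Y N → ℝ)
    (hf : ∀ ω ω', (∀ j : Fin N, (j : ℕ) < m → ω.1 j = ω'.1 j) →
      (∀ j : Fin (N + 1), (j : ℕ) < m + 1 → ω.2.1 j = ω'.2.1 j) →
      (∀ j : Fin N, (j : ℕ) < m → ω.2.2 j = ω'.2.2 j) → f ω = f ω')
    (H : ∑ ω, qw ch src m (m + 1) ω * f ω = ∑ ω, qw ch src' m (m + 1) ω * f ω) :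
    ∑ ω, qw ch src (m + 1) (m + 2) ω * f ω = ∑ ω, qw ch src' (m + 1) (m + 2) ω * f ω := by
  have A : ∑ ω, qw ch src (m + 1) (m + 1) ω * f ω =
      ∑ ω, qw ch src' (m + 1) (m + 1) ω * f ω := by
    apply lens_cancel (fun ω : Traj X S Y N => ω.1 m)
    rw [step_x _ _ _ _ le_rfl (by omega), step_x _ _ _ _ le_rfl (by omega)]
    have e : ∀ ω a, f (updX m ω a) = f ω := by
      intro ω a
      apply hf
      · intro j hj
        have : j ≠ m := by rintro rfl; omega
        simp [updX, this]
      · intro j hj; rfl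
      · intro j hj; rfl
    simp only [e, ← sum_mul, src.sum_one, src'.sum_one, one_mul]
    exact H
  obtain ⟨β, _, get, upd, h1, h2, hx, hs, hy, -, -, hsum⟩ :=
    exists_lens (X := X) (Y := Y) ch m.succ
  have hq : ∀ (sr : Source X S Y N u) ω b,
      qw ch sr (m + 1) (m + 1) (upd ω b) = qw ch sr (m + 1) (m + 1) ω := by
    intro sr ω b
    apply qw_congr _ _ _ _ (by omega) (by omega)
    · intro j _; rw [hx]
    · intro j hj; exact hs _ _ _ (by rintro rfl; simp at hj)
    · intro j hj; exact hy _ _ _ (by simp; omega)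
  have e : ∀ ω b, f (upd ω b) = f ω := by
    intro ω b
    apply hf
    · intro j _; rw [hx]
    · intro j hj; exact hs _ _ _ (by rintro rfl; simp at hj)
    · intro j hj; exact hy _ _ _ (by simp; omega)
  apply lens_cancel get
  have hm : ∀ (sr : Source X S Y N u) ω, qw ch sr (m + 1) (m + 2) ω =
      qw ch sr (m + 1) (m + 1) ω * lev ch m.succ ω := fun sr ω => by
    have := qw_succ_l ch sr (m + 1) m.succ ω
    simpa using this
  simp only [hm]
  rw [lens_sum get upd h1 h2 _ _ _ (hq src), lens_sum get upd h1 h2 _ _ _ (hq src')]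
  simp only [e, ← sum_mul, hsum, one_mul]
  exact A

/-- Conditional averaging over the classes of an equivalence relation. -/
theorem avg_lemma {Ω : Type} [Fintype Ω] (r : Ω → Ω → Prop) [DecidableRel r]
    (hrefl : ∀ a, r a a) (hsymm : ∀ a b, r a b → r b a)
    (htrans : ∀ a b c, r a b → r b c → r a c)
    (q κ d g : Ω → ℝ) (hq : ∀ ω, 0 ≤ q ω) (hg : ∀ a b, r a b → g a = g b) :
    ∑ ω, q ω * ((if (∑ z, if r ω z then q z else 0) = 0 then d ω else
        (∑ z, if r ω z then q z * κ z else 0) / (∑ z, if r ω z then q z else 0)) * g ω) =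
      ∑ ω, q ω * (κ ω * g ω) := by
  set B : Ω → ℝ := fun ω => ∑ z, if r ω z then q z else 0 with hB
  have hB0 : ∀ ω, B ω = 0 → q ω = 0 := by
    intro ω h
    have := (sum_eq_zero_iff_of_nonneg (fun z _ => by
      split_ifs
      · exact hq z
      · exact le_rfl)).1 h ω (mem_univ _)
    simpa [hrefl] using this
  have hBc : ∀ a b, r a b → B a = B b := by
    intro a b hab
    refine sum_congr rfl fun z _ => ?_
    have : r a z ↔ r b z :=
      ⟨fun h => htrans _ _ _ (hsymm _ _ hab) h, fun h => htrans _ _ _ hab h⟩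
    simp [this]
  have L : ∀ ω, q ω * ((if B ω = 0 then d ω else
      (∑ z, if r ω z then q z * κ z else 0) / B ω) * g ω) =
      ∑ z, if r z ω then q ω * (q z * κ z * g z / B z) else 0 := by
    intro ω
    by_cases h : B ω = 0
    · simp [hB0 ω h]
    · rw [if_neg h, div_mul_eq_mul_div, sum_mul, sum_div, mul_sum]
      refine sum_congr rfl fun z _ => ?_
      by_cases hz : r ω z
      · rw [if_pos hz, if_pos (hsymm _ _ hz), hg _ _ hz, hBc _ _ hz]
      · rw [if_neg hz, if_neg (fun h => hz (hsymm _ _ h))]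
        simp
  change ∑ ω, q ω * ((if B ω = 0 then d ω else
      (∑ z, if r ω z then q z * κ z else 0) / B ω) * g ω) = _
  simp only [L]
  rw [sum_comm]
  refine sum_congr rfl fun z _ => ?_
  have : ∀ ω, (if r z ω then q ω * (q z * κ z * g z / B z) else 0) =
      (if r z ω then q ω else 0) * (q z * κ z * g z / B z) := by
    intro ω; split_ifs <;> simp
  simp only [this, ← sum_mul]
  change B z * _ = _
  by_cases h : B z = 0
  · simp [h, hB0 z h]
  · field_simp

theorem rel_refl {N : ℕ} (v a b k : ℕ) (ω : Traj X S Y N) : rel v a b k ω ω :=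
  ⟨fun _ _ => rfl, fun _ _ => rfl, fun _ _ => rfl⟩

theorem rel_symm {N : ℕ} (v a b k : ℕ) (ω ω' : Traj X S Y N) (h : rel v a b k ω ω') :
    rel v a b k ω' ω :=
  ⟨fun j hj => (h.1 j hj).symm, fun j hj => (h.2.1 j hj).symm, fun j hj => (h.2.2 j hj).symm⟩

theorem rel_trans {N : ℕ} (v a b k : ℕ) (ω ω' ω'' : Traj X S Y N) (h : rel v a b k ω ω')
    (h' : rel v a b k ω' ω'') : rel v a b k ω ω'' :=
  ⟨fun j hj => (h.1 j hj).trans (h'.1 j hj), fun j hj => (h.2.1 j hj).trans (h'.2.1 j hj),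
    fun j hj => (h.2.2 j hj).trans (h'.2.2 j hj)⟩

open Classical in
/-- The Markovized policy. -/
def mpol {N u : ℕ} (v : ℕ) (ch : NCFSC X S Y) (src : Source X S Y N u) (t : Fin N)
    (a : X) (ω : Traj X S Y N) : ℝ :=
  if (∑ z, if rel v t t (t + 1 - u) ω z then qw ch src t (t + 1 - u) z else 0) = 0 then
    (Fintype.card X : ℝ)⁻¹
  else
    (∑ z, if rel v t t (t + 1 - u) ω z then
        qw ch src t (t + 1 - u) z * src.pol t z.1 z.2.1 z.2.2 a else 0) /
      (∑ z, if rel v t t (t + 1 - u) ω z then qw ch src t (t + 1 - u) z else 0)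

theorem mpol_congr {N u : ℕ} (v : ℕ) (ch : NCFSC X S Y) (src : Source X S Y N u) (t : Fin N)
    (a : X) (ω ω' : Traj X S Y N) (h : rel v t t (t + 1 - u) ω ω') :
    mpol v ch src t a ω = mpol v ch src t a ω' := by
  have : ∀ z, rel v t t (t + 1 - u) ω z ↔ rel v t t (t + 1 - u) ω' z := fun z =>
    ⟨fun h' => rel_trans _ _ _ _ _ _ _ (rel_symm _ _ _ _ _ _ h) h',
      fun h' => rel_trans _ _ _ _ _ _ _ h h'⟩
  have E : rel v t t (t + 1 - u) ω = rel v t t (t + 1 - u) ω' :=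
    funext fun z => propext (this z)
  unfold mpol
  rw [E]

theorem mpol_congr' {N u : ℕ} (v : ℕ) (ch : NCFSC X S Y) (src : Source X S Y N u) (t : Fin N)
    (x x' : Fin N → X) (s s' : Fin (N + 1) → S) (y y' : Fin N → Y)
    (hx : ∀ j : Fin N, (t : ℕ) ≤ (j : ℕ) + v ∧ (j : ℕ) < (t : ℕ) → x j = x' j)
    (hs : ∀ j : Fin (N + 1), (t : ℕ) ≤ (j : ℕ) + v ∧ (j : ℕ) + u ≤ (t : ℕ) → s j = s' j)
    (hy : ∀ j : Fin N, (j : ℕ) + u + 1 ≤ (t : ℕ) → y j = y' j) :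
    (fun a => mpol v ch src t a (x, s, y)) = fun a => mpol v ch src t a (x', s', y') := by
  funext a
  apply mpol_congr
  exact ⟨fun j hj => hx j hj, fun j hj => hs j (by omega), fun j hj => hy j (by omega)⟩

/-- The Markovized source. -/
def msrc {N u : ℕ} (v : ℕ) (ch : NCFSC X S Y) (src : Source X S Y N u) : Source X S Y N u where
  pol t x s y a := mpol v ch src t a (x, s, y)
  nonneg := by
    intro t x s y a
    unfold mpol
    split_ifs
    · positivity
    · refine div_nonneg (sum_nonneg fun z _ => ?_) (sum_nonneg fun z _ => ?_)
      · split_ifs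
        · exact mul_nonneg (qw_nonneg _ _ _ _ _) (src.nonneg _ _ _ _ _)
        · exact le_rfl
      · split_ifs
        · exact qw_nonneg _ _ _ _ _
        · exact le_rfl
  sum_one := by
    intro t x s y
    unfold mpol
    split_ifs with h
    · have : Nonempty X := ⟨x t⟩
      have hc : (Fintype.card X : ℝ) ≠ 0 := by exact_mod_cast Fintype.card_ne_zero
      simp [hc]
    · rw [← sum_div, sum_comm, div_eq_one_iff_eq h]
      refine sum_congr rfl fun z _ => ?_
      split_ifs
      · rw [← mul_sum, src.sum_one, mul_one]
      · simp
  causal := by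
    intro t x x' s s' y y' hx hs hy
    exact mpol_congr' v ch src t x x' s s' y y' (fun j hj => hx j hj.2)
      (fun j hj => hs j hj.2) hy

theorem msrc_markov {N u : ℕ} (v : ℕ) (ch : NCFSC X S Y) (src : Source X S Y N u) :
    IsMarkov v (msrc v ch src) := by
  intro t x x' s s' y y' hx hs hy
  exact mpol_congr' v ch src t x x' s s' y y' hx hs hy

theorem step_pol {N u : ℕ} (v : ℕ) (ch : NCFSC X S Y) (src : Source X S Y N u) (t : Fin N)
    (H : ∀ f : Traj X S Y N → ℝ, (∀ ω ω', rel v t t (t + 1 - u) ω ω' → f ω = f ω') →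
      ∑ ω, qw ch src t (t + 1 - u) ω * f ω = ∑ ω, qw ch (msrc v ch src) t (t + 1 - u) ω * f ω)
    (f : Traj X S Y N → ℝ) (hf : ∀ ω ω', rel v t (t + 1) (t + 1 - u) ω ω' → f ω = f ω') :
    ∑ ω, qw ch src (t + 1) (t + 1 - u) ω * f ω =
      ∑ ω, qw ch (msrc v ch src) (t + 1) (t + 1 - u) ω * f ω := by
  have hg : ∀ a ω ω', rel v t t (t + 1 - u) ω ω' → f (updX t ω a) = f (updX t ω' a) := by
    rintro a ω ω' ⟨r1, r2, r3⟩
    apply hf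
    refine ⟨fun j hj => ?_, r2, r3⟩
    by_cases e : j = t
    · simp [updX, e]
    · have : (j : ℕ) ≠ t := fun h => e (Fin.ext h)
      simpa [updX, e] using r1 j (by omega)
  apply lens_cancel (fun ω : Traj X S Y N => ω.1 t)
  rw [step_x _ _ _ _ (by omega) (by omega), step_x _ _ _ _ (by omega) (by omega)]
  rw [← H]
  · simp only [mul_sum]
    rw [sum_comm]
    conv_rhs => rw [sum_comm]
    refine sum_congr rfl fun a _ => ?_
    classical
    have := avg_lemma (rel (X := X) (S := S) (Y := Y) (N := N) v t t (t + 1 - u))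
      (rel_refl _ _ _ _) (rel_symm _ _ _ _) (rel_trans _ _ _ _) (qw ch src t (t + 1 - u))
      (fun z => src.pol t z.1 z.2.1 z.2.2 a) (fun _ => (Fintype.card X : ℝ)⁻¹)
      (fun ω => f (updX t ω a)) (qw_nonneg _ _ _ _) (hg a)
    rw [← this]
    refine sum_congr rfl fun ω _ => ?_
    simp only [msrc, mpol]
  · intro ω ω' h
    refine sum_congr rfl fun a _ => ?_
    rw [hg a ω ω' h]
    congr 1
    exact mpol_congr v ch src t a ω ω' h

theorem main_claim {N u : ℕ} (v : ℕ) (huv : u ≤ v) (ch : NCFSC X S Y) (src : Source X S Y N u)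
    (t : ℕ) (htN : t ≤ N) :
    ∀ f : Traj X S Y N → ℝ, (∀ ω ω', rel v t t (t + 1 - u) ω ω' → f ω = f ω') →
      ∑ ω, qw ch src t (t + 1 - u) ω * f ω =
        ∑ ω, qw ch (msrc v ch src) t (t + 1 - u) ω * f ω := by
  induction t with
  | zero => intro f _; simp [qw]
  | succ t ih =>
    have H := step_pol v ch src ⟨t, htN⟩ (ih (by omega))
    simp only at H
    intro f hf
    by_cases h : t + 1 < u
    · have e1 : t + 1 + 1 - u = t + 1 - u := by omega
      rw [e1] at hf ⊢
      apply H
      rintro ω ω' ⟨r1, r2, r3⟩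
      exact hf _ _ ⟨fun j hj => r1 j (by omega), fun j hj => r2 j (by omega), r3⟩
    · have e1 : t + 1 + 1 - u = t + 1 - u + 1 := by omega
      rw [e1] at hf ⊢
      refine step_l ch src (msrc v ch src) v huv t ⟨t + 1 - u, by omega⟩ (by simp)
        (by simp; omega) H f ?_
      rintro ω ω' ⟨r1, r2, r3⟩
      exact hf _ _ ⟨fun j hj => r1 j (by omega), fun j hj => r2 j (by simp; omega), r3⟩

theorem claim_level {N u : ℕ} (v : ℕ) (huv : u ≤ v) (ch : NCFSC X S Y) (src : Source X S Y N u)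
    (t : Fin N) (k : ℕ) (hk : k ≤ t + 2) (hk' : (t : ℕ) + 1 - u ≤ k) :
    ∀ f : Traj X S Y N → ℝ, (∀ ω ω', rel v t (t + 1) k ω ω' → f ω = f ω') →
      ∑ ω, qw ch src (t + 1) k ω * f ω = ∑ ω, qw ch (msrc v ch src) (t + 1) k ω * f ω := by
  induction k, hk' using Nat.le_induction with
  | base => exact step_pol v ch src t (main_claim v huv ch src t t.2.le)
  | succ k hk' ih =>
    exact step_l ch src (msrc v ch src) v huv t ⟨k, by omega⟩ (by simp; omega)
      (by simp; omega) (ih (by omega))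

theorem claim_full {N u : ℕ} (v : ℕ) (huv : u ≤ v) (ch : NCFSC X S Y) (src : Source X S Y N u)
    (t : Fin N) (f : Traj X S Y N → ℝ)
    (hf : ∀ ω ω', rel v t (t + 1) (t + 2) ω ω' → f ω = f ω') :
    ∑ ω, jointP ch src ω * f ω = ∑ ω, jointP ch (msrc v ch src) ω * f ω := by
  have key : ∀ m : ℕ, (t : ℕ) + 1 ≤ m → m ≤ N →
      ∑ ω, qw ch src m (m + 1) ω * f ω =
        ∑ ω, qw ch (msrc v ch src) m (m + 1) ω * f ω := by
    intro m hm
    induction m, hm using Nat.le_induction with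
    | base => intro _; exact claim_level v huv ch src t (t + 2) le_rfl (by omega) f hf
    | succ m hm ih =>
      intro hmN
      refine step_up ch src (msrc v ch src) ⟨m, hmN⟩ f ?_ (ih (by omega))
      intro ω ω' r1 r2 r3
      exact hf _ _ ⟨fun j hj => r1 j (by simp; omega), fun j hj => r2 j (by simp; omega),
        fun j hj => r3 j (by simp; omega)⟩
  have := key N t.2 le_rfl
  simpa only [qw_top] using this

theorem condMI_congr {Ω A B C : Type} [Fintype Ω] [Fintype A] [Fintype B] [Fintype C]
    (p p' : Ω → ℝ) (fA : Ω → A) (fB : Ω → B) (fC : Ω → C)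
    (H : ∀ E : Set Ω, (∀ ω ω', fA ω = fA ω' → fB ω = fB ω' → fC ω = fC ω' →
      (ω ∈ E ↔ ω' ∈ E)) → prE p E = prE p' E) :
    condMI p fA fB fC = condMI p' fA fB fC := by
  unfold condMI condPr
  refine sum_congr rfl fun a _ => sum_congr rfl fun b _ => sum_congr rfl fun c _ => ?_
  rw [H {ω | fA ω = a ∧ fB ω = b ∧ fC ω = c}, H ({ω | fA ω = a ∧ fB ω = b} ∩ {ω | fC ω = c}),
    H ({ω | fA ω = a} ∩ {ω | fC ω = c}), H ({ω | fB ω = b} ∩ {ω | fC ω = c}),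
    H {ω | fC ω = c}]
  all_goals
    intro ω ω' h1 h2 h3
    simp [h1, h2, h3]

theorem objWin_msrc {N u : ℕ} (v : ℕ) (huv : u ≤ v) (ch : NCFSC X S Y) (src : Source X S Y N u) :
    objWin v ch src = objWin v ch (msrc v ch src) := by
  unfold objWin
  refine sum_congr rfl fun t _ => ?_
  apply condMI_congr
  intro E hE
  have e : ∀ p : Traj X S Y N → ℝ, prE p E = ∑ ω, p ω * E.indicator (fun _ => (1 : ℝ)) ω := by
    intro p
    refine sum_congr rfl fun ω _ => ?_
    by_cases h : ω ∈ E <;> simp [h]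
  rw [e, e]
  apply claim_full v huv ch src t
  rintro ω ω' ⟨r1, r2, r3⟩
  have : ω ∈ E ↔ ω' ∈ E := by
    apply hE
    · refine Prod.ext ?_ ?_
      · funext j; exact r1 j.1 (by have := j.2; omega)
      · funext j; exact r2 j.1 (by have := j.2; omega)
    · exact r3 t (by omega)
    · funext j; exact r3 j.1 (by have := j.2; omega)
  by_cases h : ω ∈ E
  · simp [h, this.1 h]
  · have hne : ω' ∉ E := fun hmem => h (this.2 hmem)
    simp only [Set.indicator_of_notMem h, Set.indicator_of_notMem hne]

/-- **Theorem 2, finite-horizon supremum form.** For a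
non-controllable FSC and `0 ≤ u ≤ v`, the supremum of
`Σ_{t=1}^N I(X_{t-v}^t, S_{t-v-1}; Y_t | Y^{t-1})` over all sources with
`u`-delayed FB and `u`-delayed SI is attained within the class of `v`-th
order conditional Markov sources. -/
theorem statement7 {X S Y : Type} [Fintype X] [Fintype S] [Fintype Y] {N : ℕ}
    (ch : NCFSC X S Y) (u v : ℕ) (huv : u ≤ v) :
    (⨆ src : Source X S Y N u, objWin v ch src) =
      ⨆ src : {P : Source X S Y N u // IsMarkov v P}, objWin v ch src.1 := by
  unfold iSup
  congr 1
  ext r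
  constructor
  · rintro ⟨src, rfl⟩
    exact ⟨⟨msrc v ch src, msrc_markov v ch src⟩, (objWin_msrc v huv ch src).symm⟩
  · rintro ⟨src, rfl⟩
    exact ⟨src.1, rfl⟩

end FSCPaper
end
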